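/- arXiv:2405.13074 — 2 statements merged into one kernel-verified Lean document; each statement's English description precedes it below -/
import Mathlib

section
/- For all m ≥ 0, LaH(m) = (1/ρ) • ( r•Ψ + (1/(ψ₁−ψ₂)) • (Φ₁·ψ₁ᵐ • Ψ₁ − Φ₂·ψ₂ᵐ • Ψ₂) ) (Binet formula for generalized Leonardo-Alwyn hybrid numbers). -/
/-- The generalized Leonardo-Alwyn recurrence has an inhomogeneous second order form. -/
theorem leonardoAlwyn_second_order {p q r : ℝ} {L : ℕ → ℝ}
    (hL2 : L 2 = p * L 1 + q * L 0 + r)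
    (hLrec : ∀ n : ℕ, L (n + 3) = (1 + p) * L (n + 2) + (q - p) * L (n + 1) - q * L n)
    (n : ℕ) : L (n + 2) = p * L (n + 1) + q * L n + r := by
  induction n with
  | zero => exact hL2
  | succ n ih =>
    have h := hLrec n
    change L (n + 3) = p * L (n + 2) + q * L (n + 1) + r
    linarith

/-- Binet formula for an inhomogeneous second order recurrence whose characteristic polynomial
has the distinct roots `x` and `y`, neither equal to `1`. -/
theorem binet_of_second_order {x y r : ℝ} {L : ℕ → ℝ} (hxy : x - y ≠ 0)
    (hρ : 1 - (x + y) + x * y ≠ 0)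
    (hL : ∀ n : ℕ, L (n + 2) = (x + y) * L (n + 1) - x * y * L n + r) (n : ℕ) :
    L n = 1 / (1 - (x + y) + x * y) * (r + 1 / (x - y) *
      (((1 - (x + y) + x * y) * (L 1 - y * L 0) - (1 - y) * r) * x ^ n
        - ((1 - (x + y) + x * y) * (L 1 - x * L 0) - (1 - x) * r) * y ^ n)) := by
  induction n using Nat.twoStepInduction with
  | zero => field_simp; ring
  | one => field_simp; ring
  | more n ih₀ ih₁ =>
    rw [hL n, ih₁, ih₀]
    generalize L 0 = a, L 1 = b
    field_simp
    ring


/-- Binet formula for generalized Leonardo-Alwyn hybrid numbers. -/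
theorem leonardoAlwyn_hybrid_binet
    (p q r a b : ℝ) (hpq : p + q ≠ 1) (hdisc : p ^ 2 + 4 * q > 0)
    (L : ℕ → ℝ)
    (hL0 : L 0 = a) (hL1 : L 1 = b) (hL2 : L 2 = p * b + q * a + r)
    (hLrec : ∀ n : ℕ, L (n + 3) = (1 + p) * L (n + 2) + (q - p) * L (n + 1) - q * L n)
    (ρ ψ₁ ψ₂ Φ₁ Φ₂ : ℝ)
    (hρ : ρ = 1 - p - q)
    (hψ₁ : ψ₁ = (p + Real.sqrt (p ^ 2 + 4 * q)) / 2)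
    (hψ₂ : ψ₂ = (p - Real.sqrt (p ^ 2 + 4 * q)) / 2)
    (hΦ₁ : Φ₁ = ((1 - p - q) * a - r) * ψ₁ + (1 - p - q) * b + (p ^ 2 + p * q - p) * a
        + (p - 1) * r)
    (hΦ₂ : Φ₂ = ((1 - p - q) * a - r) * ψ₂ + (1 - p - q) * b + (p ^ 2 + p * q - p) * a
        + (p - 1) * r)
    (I E H : Matrix (Fin 2) (Fin 2) ℝ)
    (hI : I = !![0, 1; -1, 0]) (hE : E = !![1, -1; 1, -1]) (hH : H = !![0, 1; 1, 0])
    (LaH : ℕ → Matrix (Fin 2) (Fin 2) ℝ)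
    (hLaH : ∀ m : ℕ, LaH m = L m • (1 : Matrix (Fin 2) (Fin 2) ℝ)
        + L (m + 1) • I + L (m + 2) • E + L (m + 3) • H)
    (Ψ Ψ₁ Ψ₂ : Matrix (Fin 2) (Fin 2) ℝ)
    (hΨ : Ψ = 1 + I + E + H)
    (hΨ₁ : Ψ₁ = 1 + ψ₁ • I + ψ₁ ^ 2 • E + ψ₁ ^ 3 • H)
    (hΨ₂ : Ψ₂ = 1 + ψ₂ • I + ψ₂ ^ 2 • E + ψ₂ ^ 3 • H) :
    ∀ m : ℕ, LaH m = (1 / ρ) • (r • Ψ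
      + (1 / (ψ₁ - ψ₂)) • ((Φ₁ * ψ₁ ^ m) • Ψ₁ - (Φ₂ * ψ₂ ^ m) • Ψ₂)) := by
  have hsq : Real.sqrt (p ^ 2 + 4 * q) ^ 2 = p ^ 2 + 4 * q := Real.sq_sqrt hdisc.le
  have hpos : 0 < Real.sqrt (p ^ 2 + 4 * q) := Real.sqrt_pos.mpr hdisc
  have hp : ψ₁ + ψ₂ = p := by rw [hψ₁, hψ₂]; ring
  have hq : ψ₁ * ψ₂ = -q := by rw [hψ₁, hψ₂]; linear_combination -hsq / 4
  have hne : ψ₁ - ψ₂ ≠ 0 := by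
    have : ψ₁ - ψ₂ = Real.sqrt (p ^ 2 + 4 * q) := by rw [hψ₁, hψ₂]; ring
    rw [this]
    exact hpos.ne'
  have hρ' : 1 - (ψ₁ + ψ₂) + ψ₁ * ψ₂ = ρ := by rw [hp, hq, hρ]; ring
  have hρ0 : ρ ≠ 0 := fun h => hpq (by linarith)
  have hbinet (n : ℕ) :
      L n = 1 / ρ * (r + 1 / (ψ₁ - ψ₂) * (Φ₁ * ψ₁ ^ n - Φ₂ * ψ₂ ^ n)) := by
    have hrec (n : ℕ) : L (n + 2) = (ψ₁ + ψ₂) * L (n + 1) - ψ₁ * ψ₂ * L n + r := by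
      rw [hp, hq, leonardoAlwyn_second_order (by rw [hL2, hL1, hL0]) hLrec n]
      ring
    have h := binet_of_second_order hne (hρ' ▸ hρ0) hrec n
    have e₁ : ρ * (b - ψ₂ * a) - (1 - ψ₂) * r = Φ₁ := by
      rw [hΦ₁, hρ]
      linear_combination (r - (1 - p - q) * a) * hp
    have e₂ : ρ * (b - ψ₁ * a) - (1 - ψ₁) * r = Φ₂ := by
      rw [hΦ₂, hρ]
      linear_combination (r - (1 - p - q) * a) * hp
    rwa [hρ', hL0, hL1, e₁, e₂] at h
  intro m
  rw [hLaH, hΨ, hΨ₁, hΨ₂, hbinet m, hbinet (m + 1), hbinet (m + 2), hbinet (m + 3)]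
  module
end

section
/- (Catalan identity) For all natural numbers n, u with u ≤ n, LaH(n+u)·LaH(n−u) − (LaH(n))² = (1/ρ²) • ( (1/(ψ₁−ψ₂)²) • (Φ₁·Φ₂·(−q)^{n−u}·(ψ₁ᵘ−ψ₂ᵘ)) • (ψ₂ᵘ • (Ψ₂·Ψ₁) − ψ₁ᵘ • (Ψ₁·Ψ₂)) + r • (Ψ·𝒦(n−u,u) − 𝒦(n,u)·Ψ) ), where 𝒦(n,u) = ℋ(n) − ℋ(n+u). -/
/-- A third-order recurrence with characteristic root `1` reduces to a second-order recurrence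
with a constant inhomogeneity. -/
theorem second_order_of_third_order {p q r : ℝ} {L : ℕ → ℝ}
    (h2 : L 2 = p * L 1 + q * L 0 + r)
    (hrec : ∀ n : ℕ, L (n + 3) = (1 + p) * L (n + 2) + (q - p) * L (n + 1) - q * L n) (n : ℕ) :
    L (n + 2) = p * L (n + 1) + q * L n + r := by
  induction n with
  | zero => simpa using h2
  | succ k ih => linear_combination hrec k + ih

/-- Binet formula for an inhomogeneous second-order recurrence with characteristic roots
`x` and `y`, cleared of denominators. -/
theorem binet_inhomogeneous {p q r x y : ℝ} {L : ℕ → ℝ} (hsum : x + y = p) (hprod : x * y = -q)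
    (hrec : ∀ n : ℕ, L (n + 2) = p * L (n + 1) + q * L n + r) (n : ℕ) :
    (1 - p - q) * (x - y) * L n = r * (x - y)
      + ((1 - p - q) * (L 1 - y * L 0) - r * (1 - y)) * x ^ n
      - ((1 - p - q) * (L 1 - x * L 0) - r * (1 - x)) * y ^ n := by
  obtain rfl : q = -(x * y) := by linarith
  subst hsum
  induction n using Nat.twoStepInduction with
  | zero => ring
  | one => ring
  | more k ih₀ ih₁ =>
    rw [hrec k]
    linear_combination (x + y) * ih₁ - x * y * ih₀

/-- Catalan identity for the shifted Binet sequence `n ↦ r • P + d • (s xⁿ • X - t yⁿ • Y)` in an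
associative algebra. -/
theorem catalan_of_binet {A : Type*} [Ring A] [Algebra ℝ A] (r d s t x y : ℝ) (P X Y : A)
    {F G : ℕ → A} (hG : ∀ n, G n = d • ((s * x ^ n) • X - (t * y ^ n) • Y))
    (hF : ∀ n, F n = r • P + G n) (k u : ℕ) :
    F (k + u + u) * F k - F (k + u) ^ 2
      = d ^ 2 • (s * t * (x * y) ^ k * (x ^ u - y ^ u)) • (y ^ u • (Y * X) - x ^ u • (X * Y))
        + r • (P * (G k - G (k + u)) - (G (k + u) - G (k + u + u)) * P) := by
  simp only [hF, hG, pow_two (_ + _ : A), mul_add, add_mul, mul_sub, sub_mul, smul_mul_assoc,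
    mul_smul_comm, mul_pow, pow_add]
  module


/-- Catalan identity for generalized Leonardo-Alwyn hybrid numbers. -/
theorem leonardoAlwyn_hybrid_catalan
    (p q r a b : ℝ) (hpq : p + q ≠ 1) (hdisc : p ^ 2 + 4 * q > 0)
    (L : ℕ → ℝ)
    (hL0 : L 0 = a) (hL1 : L 1 = b) (hL2 : L 2 = p * b + q * a + r)
    (hLrec : ∀ n : ℕ, L (n + 3) = (1 + p) * L (n + 2) + (q - p) * L (n + 1) - q * L n)
    (ρ ψ₁ ψ₂ Φ₁ Φ₂ : ℝ)
    (hρ : ρ = 1 - p - q)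
    (hψ₁ : ψ₁ = (p + Real.sqrt (p ^ 2 + 4 * q)) / 2)
    (hψ₂ : ψ₂ = (p - Real.sqrt (p ^ 2 + 4 * q)) / 2)
    (hΦ₁ : Φ₁ = ((1 - p - q) * a - r) * ψ₁ + (1 - p - q) * b + (p ^ 2 + p * q - p) * a
        + (p - 1) * r)
    (hΦ₂ : Φ₂ = ((1 - p - q) * a - r) * ψ₂ + (1 - p - q) * b + (p ^ 2 + p * q - p) * a
        + (p - 1) * r)
    (I E H : Matrix (Fin 2) (Fin 2) ℝ)
    (hI : I = !![0, 1; -1, 0]) (hE : E = !![1, -1; 1, -1]) (hH : H = !![0, 1; 1, 0])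
    (LaH : ℕ → Matrix (Fin 2) (Fin 2) ℝ)
    (hLaH : ∀ m : ℕ, LaH m = L m • (1 : Matrix (Fin 2) (Fin 2) ℝ)
        + L (m + 1) • I + L (m + 2) • E + L (m + 3) • H)
    (Ψ Ψ₁ Ψ₂ : Matrix (Fin 2) (Fin 2) ℝ)
    (hΨ : Ψ = 1 + I + E + H)
    (hΨ₁ : Ψ₁ = 1 + ψ₁ • I + ψ₁ ^ 2 • E + ψ₁ ^ 3 • H)
    (hΨ₂ : Ψ₂ = 1 + ψ₂ • I + ψ₂ ^ 2 • E + ψ₂ ^ 3 • H)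
    (HH : ℕ → Matrix (Fin 2) (Fin 2) ℝ)
    (hHH : ∀ n : ℕ, HH n = (1 / (ψ₁ - ψ₂)) • ((Φ₁ * ψ₁ ^ n) • Ψ₁ - (Φ₂ * ψ₂ ^ n) • Ψ₂))
    (KK : ℕ → ℕ → Matrix (Fin 2) (Fin 2) ℝ)
    (hKK : ∀ n u : ℕ, KK n u = HH n - HH (n + u)) :
    ∀ n u : ℕ, u ≤ n → LaH (n + u) * LaH (n - u) - (LaH n) ^ 2
      = (1 / ρ ^ 2) • ((1 / (ψ₁ - ψ₂) ^ 2) • (Φ₁ * Φ₂ * (-q) ^ (n - u) * (ψ₁ ^ u - ψ₂ ^ u))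
            • (ψ₂ ^ u • (Ψ₂ * Ψ₁) - ψ₁ ^ u • (Ψ₁ * Ψ₂))
          + r • (Ψ * KK (n - u) u - KK n u * Ψ)) := by
  have hsq := Real.sq_sqrt hdisc.le
  have hsum : ψ₁ + ψ₂ = p := by rw [hψ₁, hψ₂]; ring
  have hprod : ψ₁ * ψ₂ = -q := by rw [hψ₁, hψ₂]; linear_combination -hsq / 4
  have hd : ψ₁ - ψ₂ ≠ 0 := by
    rw [show ψ₁ - ψ₂ = Real.sqrt (p ^ 2 + 4 * q) by rw [hψ₁, hψ₂]; ring]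
    exact (Real.sqrt_pos.mpr hdisc).ne'
  have hρ0 : ρ ≠ 0 := fun h => hpq (by linarith)
  have hrec := second_order_of_third_order (p := p) (q := q) (r := r) (by rw [hL2, hL1, hL0]) hLrec
  have hL : ∀ m, ρ * L m = r + 1 / (ψ₁ - ψ₂) * (Φ₁ * ψ₁ ^ m - Φ₂ * ψ₂ ^ m) := by
    intro m
    have hbinet := binet_inhomogeneous hsum hprod hrec m
    rw [hL0, hL1, ← hρ] at hbinet
    have h₁ : Φ₁ = ρ * (b - ψ₂ * a) - r * (1 - ψ₂) := by
      rw [hΦ₁, hρ]; linear_combination ((1 - p - q) * a - r) * hsum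
    have h₂ : Φ₂ = ρ * (b - ψ₁ * a) - r * (1 - ψ₁) := by
      rw [hΦ₂, hρ]; linear_combination ((1 - p - q) * a - r) * hsum
    rw [← h₁, ← h₂] at hbinet
    field_simp
    linear_combination hbinet
  have hF : ∀ m, ρ • LaH m = r • Ψ + HH m := by
    intro m
    simp only [hLaH, smul_add, smul_smul, hL]
    rw [hHH, hΨ, hΨ₁, hΨ₂]
    module
  intro n u hun
  obtain ⟨k, rfl⟩ := Nat.exists_eq_add_of_le' hun
  have hcat := catalan_of_binet (F := fun m => ρ • LaH m) r _ Φ₁ Φ₂ ψ₁ ψ₂ Ψ Ψ₁ Ψ₂ hHH hF k u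
  rw [Nat.add_sub_cancel, hKK, hKK, ← hprod, ← one_div_pow (ψ₁ - ψ₂), ← hcat]
  simp only [smul_mul_smul_comm, smul_pow, ← pow_two ρ, ← smul_sub, smul_smul]
  rw [one_div_mul_cancel (pow_ne_zero 2 hρ0), one_smul]
end
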